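/- Let n ≥ 2 and let BS(1,n) = ⟨a, b ∣ b⁻¹ab = aⁿ⟩ with generating set S = {a, b}. Then the word length of a^k with respect to S is Θ(log k): there exists a constant C ≥ 1 such that for all integers k ≥ 2, (1/C)·log k ≤ |a^k|_S ≤ C·log k. -/

import Mathlib

/-- The ball of radius `n` in a group `G` with respect to a generating set `S`:
all products of at most `n` elements of `S ∪ S⁻¹`. -/
def wordBall {G : Type*} [Group G] (S : Set G) (n : ℕ) : Set G :=
  {g | ∃ L : List G, L.length ≤ n ∧ (∀ x ∈ L, x ∈ S ∪ S⁻¹) ∧ L.prod = g}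

/-- The word length of `g` with respect to `S`: the least `n` such that `g` is a
product of `n` elements of `S ∪ S⁻¹`. -/
noncomputable def wordLength {G : Type*} [Group G] (S : Set G) (g : G) : ℕ :=
  sInf {n : ℕ | g ∈ wordBall S n}

/-- The defining relation `b⁻¹ aᵐ b (aⁿ)⁻¹` of the Baumslag–Solitar group. -/
def bsRels (m n : ℕ) : Set (FreeGroup (Fin 2)) :=
  {(FreeGroup.of 1)⁻¹ * (FreeGroup.of 0) ^ m * FreeGroup.of 1 * ((FreeGroup.of 0) ^ n)⁻¹}

/-- The Baumslag–Solitar group `BS(m,n) = ⟨a, b ∣ b⁻¹ aᵐ b = aⁿ⟩`. -/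
abbrev BS (m n : ℕ) : Type := PresentedGroup (bsRels m n)

/-- The generator `a` of `BS(m,n)`. -/
def bsA (m n : ℕ) : BS m n := PresentedGroup.of 0

/-- The generator `b` of `BS(m,n)`. -/
def bsB (m n : ℕ) : BS m n := PresentedGroup.of 1

section WordBall

variable {G : Type*} [Group G] {S : Set G} {g h : G} {m n : ℕ}

theorem wordBall_mono (hmn : m ≤ n) : wordBall S m ⊆ wordBall S n := by
  rintro g ⟨L, hL, hS, rfl⟩
  exact ⟨L, hL.trans hmn, hS, rfl⟩

theorem one_mem_wordBall (S : Set G) (n : ℕ) : (1 : G) ∈ wordBall S n :=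
  ⟨[], by simp, by simp, rfl⟩

theorem mul_mem_wordBall (hg : g ∈ wordBall S m) (hh : h ∈ wordBall S n) :
    g * h ∈ wordBall S (m + n) := by
  obtain ⟨L, hL, hLS, rfl⟩ := hg
  obtain ⟨M, hM, hMS, rfl⟩ := hh
  refine ⟨L ++ M, by simpa using add_le_add hL hM, fun x hx => ?_, List.prod_append⟩
  exact (List.mem_append.mp hx).elim (hLS x) (hMS x)

theorem mem_wordBall_one (hg : g ∈ S) : g ∈ wordBall S 1 :=
  ⟨[g], by simp, by simp [hg], by simp⟩

theorem inv_mem_wordBall_one (hg : g ∈ S) : g⁻¹ ∈ wordBall S 1 :=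
  ⟨[g⁻¹], by simp, by simp [hg], by simp⟩

theorem pow_mem_wordBall (hg : g ∈ S) (r : ℕ) : g ^ r ∈ wordBall S r := by
  induction r with
  | zero => simpa using one_mem_wordBall S 0
  | succ r ih => simpa [pow_succ] using mul_mem_wordBall ih (mem_wordBall_one hg)

theorem wordLength_le (hg : g ∈ wordBall S n) : wordLength S g ≤ n :=
  Nat.sInf_le hg

theorem mem_wordBall_wordLength (hg : g ∈ wordBall S n) : g ∈ wordBall S (wordLength S g) :=
  Nat.sInf_mem (s := {n : ℕ | g ∈ wordBall S n}) ⟨n, hg⟩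

end WordBall

theorem bs_relation (m n : ℕ) : (bsB m n)⁻¹ * bsA m n ^ m * bsB m n = bsA m n ^ n := by
  have h : PresentedGroup.mk (bsRels m n) ((FreeGroup.of 1)⁻¹ * (FreeGroup.of 0) ^ m *
      FreeGroup.of 1 * ((FreeGroup.of 0) ^ n)⁻¹) = 1 :=
    PresentedGroup.one_of_mem (Set.mem_singleton _)
  simp only [map_mul, map_inv, map_pow] at h
  exact mul_inv_eq_one.mp h

theorem bsA_pow_mul (n q : ℕ) :
    bsA 1 n ^ (n * q) = (bsB 1 n)⁻¹ * bsA 1 n ^ q * bsB 1 n := by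
  have h := bs_relation 1 n
  rw [pow_one] at h
  rw [pow_mul, ← h]
  simpa using conj_pow (i := q) (a := (bsB 1 n)⁻¹) (b := bsA 1 n)

theorem bsA_pow_mem_wordBall {n : ℕ} (hn : 2 ≤ n) (k : ℕ) :
    bsA 1 n ^ k ∈ wordBall ({bsA 1 n, bsB 1 n} : Set (BS 1 n)) ((n + 2) * (Nat.log n k + 1)) := by
  have ha : bsA 1 n ∈ ({bsA 1 n, bsB 1 n} : Set (BS 1 n)) := by simp
  have hb : bsB 1 n ∈ ({bsA 1 n, bsB 1 n} : Set (BS 1 n)) := by simp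
  induction k using Nat.strong_induction_on with
  | _ k ih =>
    rcases lt_or_ge k n with hk | hk
    · exact wordBall_mono (by rw [Nat.log_of_lt hk]; omega) (pow_mem_wordBall ha k)
    · have hq := ih (k / n) (Nat.div_lt_self (by omega) hn)
      have hr := pow_mem_wordBall ha (k % n)
      have hlog : Nat.log n k = Nat.log n (k / n) + 1 := Nat.log_of_one_lt_of_le hn hk
      have hmod : k % n < n := Nat.mod_lt _ (by omega)
      have hw := mul_mem_wordBall (mul_mem_wordBall
        (mul_mem_wordBall (inv_mem_wordBall_one hb) hq) (mem_wordBall_one hb)) hr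
      rw [← bsA_pow_mul, ← pow_add, Nat.div_add_mod] at hw
      refine wordBall_mono ?_ hw
      rw [hlog]
      nlinarith

/-- The action of `BS(1,n)` on the real line in which `a` is the translation by `1` and `b` is the
contraction by the factor `n`. -/
noncomputable def bsAffine {n : ℕ} (hn : n ≠ 0) : BS 1 n →* Equiv.Perm ℝ :=
  PresentedGroup.toGroup
    (f := ![Equiv.addRight 1, (Equiv.mulRight₀ (n : ℝ) (Nat.cast_ne_zero.mpr hn)).symm]) <| by
    rintro r rfl
    have h : (n : ℝ) ≠ 0 := Nat.cast_ne_zero.mpr hn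
    simp only [map_mul, map_inv, map_pow, FreeGroup.lift_apply_of, mul_inv_eq_one]
    ext x
    simp [Equiv.Perm.inv_def, add_mul, h]

theorem bsAffine_bsA {n : ℕ} (hn : n ≠ 0) : bsAffine hn (bsA 1 n) = Equiv.addRight 1 := by
  simp [bsAffine, bsA]

theorem bsAffine_bsB {n : ℕ} (hn : n ≠ 0) : bsAffine hn (bsB 1 n) =
    (Equiv.mulRight₀ (n : ℝ) (Nat.cast_ne_zero.mpr hn)).symm := by
  simp [bsAffine, bsB]

theorem abs_bsAffine_generator_add_one_le {n : ℕ} (hn : 2 ≤ n) {g : BS 1 n}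
    (hg : g ∈ ({bsA 1 n, bsB 1 n} : Set (BS 1 n)) ∪ ({bsA 1 n, bsB 1 n} : Set (BS 1 n))⁻¹)
    (x : ℝ) : |bsAffine (by omega) g x| + 1 ≤ n * (|x| + 1) := by
  have hn' : (2 : ℝ) ≤ n := by exact_mod_cast hn
  have hx := abs_nonneg x
  have hg' : g = (bsA 1 n)⁻¹ ∨ g = (bsB 1 n)⁻¹ ∨ g = bsA 1 n ∨ g = bsB 1 n := by
    simpa [or_assoc, inv_eq_iff_eq_inv] using hg
  rcases hg' with rfl | rfl | rfl | rfl
  · have := abs_add_le x (-1)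
    simp only [map_inv, bsAffine_bsA, Equiv.Perm.inv_def, Equiv.addRight_symm, Equiv.coe_addRight]
    rw [abs_neg, abs_one] at this
    nlinarith
  · simp only [map_inv, bsAffine_bsB, Equiv.Perm.inv_def, Equiv.symm_symm,
      Equiv.mulRight₀_apply, abs_mul, Nat.abs_cast]
    nlinarith
  · have := abs_add_le x 1
    simp only [bsAffine_bsA, Equiv.coe_addRight]
    rw [abs_one] at this
    nlinarith
  · have : |x * (n : ℝ)⁻¹| ≤ |x| := by
      rw [abs_mul, abs_of_nonneg (by positivity : (0 : ℝ) ≤ (n : ℝ)⁻¹)]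
      exact mul_le_of_le_one_right hx (inv_le_one_of_one_le₀ (by linarith))
    simp only [bsAffine_bsB, Equiv.mulRight₀_symm_apply]
    nlinarith

theorem abs_bsAffine_add_one_le_pow {n l : ℕ} (hn : 2 ≤ n) {g : BS 1 n}
    (hg : g ∈ wordBall ({bsA 1 n, bsB 1 n} : Set (BS 1 n)) l) :
    |bsAffine (by omega) g 0| + 1 ≤ (n : ℝ) ^ l := by
  obtain ⟨L, hL, hS, rfl⟩ := hg
  refine le_trans ?_ (pow_le_pow_right₀ (by exact_mod_cast (by omega : 1 ≤ n)) hL)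
  clear hL
  induction L with
  | nil => simp
  | cons s L ih =>
    rw [List.prod_cons, map_mul, Equiv.Perm.mul_apply, List.length_cons, pow_succ']
    refine (abs_bsAffine_generator_add_one_le hn (hS s (by simp)) _).trans ?_
    exact mul_le_mul_of_nonneg_left (ih fun x hx => hS x (by simp [hx])) (Nat.cast_nonneg n)

theorem le_pow_of_bsA_pow_mem_wordBall {n k l : ℕ} (hn : 2 ≤ n)
    (h : bsA 1 n ^ k ∈ wordBall ({bsA 1 n, bsB 1 n} : Set (BS 1 n)) l) : k ≤ n ^ l := by
  have := abs_bsAffine_add_one_le_pow hn h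
  rw [map_pow, bsAffine_bsA] at this
  simp at this
  exact_mod_cast (le_add_of_nonneg_right zero_le_one).trans this

/-- In `BS(1,n)` with `n ≥ 2` and `S = {a, b}`, the word length of `a^k` is
`Θ(log k)`: there is `C ≥ 1` such that for all `k ≥ 2`,
`(1/C)·log k ≤ |a^k|_S ≤ C·log k`. -/
theorem bs_word_length_of_power_theta_log (n : ℕ) (hn : 2 ≤ n) :
    ∃ C : ℝ, 1 ≤ C ∧ ∀ k : ℕ, 2 ≤ k →
      (1 / C) * Real.log k ≤ (wordLength ({bsA 1 n, bsB 1 n} : Set (BS 1 n)) (bsA 1 n ^ k) : ℝ) ∧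
      (wordLength ({bsA 1 n, bsB 1 n} : Set (BS 1 n)) (bsA 1 n ^ k) : ℝ) ≤ C * Real.log k := by
  have hn' : (2 : ℝ) ≤ n := by exact_mod_cast hn
  have h2 : 0 < Real.log 2 := Real.log_pos (by norm_num)
  have h21 : Real.log 2 ≤ 1 := by linarith [Real.log_two_lt_d9]
  have hlogn : Real.log 2 ≤ Real.log n := Real.log_le_log (by norm_num) hn'
  set D : ℝ := (n + 2) * 2 / Real.log 2 with hD
  have hD1 : 1 ≤ D := by
    rw [hD, le_div_iff₀ h2]
    nlinarith
  refine ⟨D + Real.log n, by linarith, fun k hk => ?_⟩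
  have hk' : (2 : ℝ) ≤ k := by exact_mod_cast hk
  have hlogk : Real.log 2 ≤ Real.log k := Real.log_le_log (by norm_num) hk'
  have hmem := bsA_pow_mem_wordBall hn k
  constructor
  · have hle := le_pow_of_bsA_pow_mem_wordBall hn (mem_wordBall_wordLength hmem)
    set l := wordLength ({bsA 1 n, bsB 1 n} : Set (BS 1 n)) (bsA 1 n ^ k)
    have hlog : Real.log k ≤ l * Real.log n := by
      rw [← Real.log_pow]
      exact Real.log_le_log (by linarith) (by exact_mod_cast hle)
    have hl : (0 : ℝ) ≤ l := Nat.cast_nonneg l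
    rw [one_div, inv_mul_le_iff₀ (by linarith)]
    nlinarith
  · have hlen : (wordLength ({bsA 1 n, bsB 1 n} : Set (BS 1 n)) (bsA 1 n ^ k) : ℝ) ≤
        (n + 2) * (Nat.log n k + 1) := by exact_mod_cast wordLength_le hmem
    have hlog : Nat.log n k * Real.log 2 ≤ Real.log k := by
      refine (mul_le_mul_of_nonneg_left hlogn (Nat.cast_nonneg _)).trans ?_
      rw [← Real.log_pow]
      exact Real.log_le_log (by positivity)
        (by exact_mod_cast Nat.pow_log_le_self n (by omega : k ≠ 0))
    have hsum : (Nat.log n k + 1 : ℝ) ≤ 2 * Real.log k / Real.log 2 := by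
      rw [le_div_iff₀ h2]
      linarith
    calc _ ≤ ((n : ℝ) + 2) * (Nat.log n k + 1) := hlen
      _ ≤ (n + 2) * (2 * Real.log k / Real.log 2) :=
        mul_le_mul_of_nonneg_left hsum (by positivity)
      _ = D * Real.log k := by rw [hD]; ring
      _ ≤ (D + Real.log n) * Real.log k :=
        mul_le_mul_of_nonneg_right (by linarith) (by linarith)
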